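/- Let K ⊆ S^{p-1} be a finite set and let A ∈ ℝ^{m×p} have i.i.d. N(0,1) entries. If m ≥ c·(1/δ²)·log|K| for a suitable absolute constant c, then with probability at least 1 - 2exp(-δ²m), for all x, y ∈ K the normalized Hamming distance d_A(x,y) := (1/m)·#{i : sign⟨A_i,x⟩ ≠ sign⟨A_i,y⟩} satisfies |d_A(x,y) - d(x,y)| ≤ δ. -/

import Mathlib

open MeasureTheory ProbabilityTheory Real

noncomputable def sgn (t : ℝ) : ℝ := if 0 ≤ t then 1 else -1

lemma charFunDual_gauss (L : StrongDual ℝ ℝ) :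
    charFunDual (gaussianReal 0 1) L = Complex.exp (((-(L 1)^2/2 : ℝ)) : ℂ) := by
  have h : charFunDual (gaussianReal 0 1) L = charFun (gaussianReal 0 1) (L 1) := by
    rw [charFunDual_apply, charFun_apply_real]
    congr 1
    ext v
    have : L v = v * L 1 := by
      have := L.map_smul v 1
      simpa using this
    rw [this]; push_cast; ring_nf
  rw [h, charFun_gaussianReal]
  push_cast
  congr 1
  simp
  ring

lemma law_eq {p : ℕ} (x y : Fin p → ℝ) (hx : ∑ i, (x i)^2 = 1) (hy : ∑ i, (y i)^2 = 1)
    (c s : ℝ) (hc : ∑ i, x i * y i = c) (hs : c^2 + s^2 = 1) :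
    (Measure.pi (fun _ : Fin p => gaussianReal 0 1)).map
      (fun a => (∑ j, a j * x j, ∑ j, a j * y j)) =
    ((gaussianReal 0 1).prod (gaussianReal 0 1)).map
      (fun u : ℝ × ℝ => (u.2, c * u.2 + s * u.1)) := by
  let f : (Fin p → ℝ) →L[ℝ] ℝ × ℝ :=
    (∑ j, (x j) • ContinuousLinearMap.proj j).prod (∑ j, (y j) • ContinuousLinearMap.proj j)
  let g : (ℝ × ℝ) →L[ℝ] ℝ × ℝ :=
    (ContinuousLinearMap.snd ℝ ℝ ℝ).prod
      (c • ContinuousLinearMap.snd ℝ ℝ ℝ + s • ContinuousLinearMap.fst ℝ ℝ ℝ)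
  have hf : (fun a : Fin p → ℝ => (∑ j, a j * x j, ∑ j, a j * y j)) = f := by
    ext a <;> simp [f, mul_comm]
  have hg : (fun u : ℝ × ℝ => (u.2, c * u.2 + s * u.1)) = g := by
    ext a <;> simp [g]
  rw [hf, hg]
  have := Measure.isProbabilityMeasure_map (μ := Measure.pi (fun _ : Fin p => gaussianReal 0 1)) (f := f) (by fun_prop)
  have := Measure.isProbabilityMeasure_map (μ := ((gaussianReal 0 1).prod (gaussianReal 0 1))) (f := g) (by fun_prop)
  apply Measure.ext_of_charFunDual
  ext L
  rw [charFunDual_map, charFunDual_map, charFunDual_pi, charFunDual_prod]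
  simp only [charFunDual_gauss]
  rw [← Complex.exp_sum, ← Complex.exp_add]
  congr 1
  norm_cast
  have hL : ∀ a b, L (a, b) = a * L (1, 0) + b * L (0, 1) := by
    intro a b
    have : ((a, b) : ℝ × ℝ) = a • (1, 0) + b • (0, 1) := by ext <;> simp
    rw [this, map_add, map_smul, map_smul]; simp
  have e1 : ∀ i, ((L.comp f).comp (.single ℝ (fun _ => ℝ) i)) 1 = L (x i, y i) := by
    intro i
    simp [f, Pi.single_apply]
  have e2 : ((L.comp g).comp (.inl ℝ ℝ ℝ)) 1 = L (0, s) := by simp [g]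
  have e3 : ((L.comp g).comp (.inr ℝ ℝ ℝ)) 1 = L (1, c) := by simp [g]
  simp only [e1, e2, e3]
  simp only [hL (x _), hL 0 s, hL 1 c]
  generalize L (1,0) = l
  generalize L (0,1) = k
  have : ∑ i, -(x i * l + y i * k)^2 / 2 =
    - (l^2 * ∑ i, (x i)^2 + 2 * l * k * ∑ i, x i * y i + k^2 * ∑ i, (y i)^2)/2 := by
    simp only [Finset.mul_sum, ← Finset.sum_add_distrib, ← Finset.sum_neg_distrib, Finset.sum_div]
    apply Finset.sum_congr rfl; intros; ring
  rw [this, hx, hy, hc]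
  linear_combination (k^2/2) * hs

lemma angle_vol (θ : ℝ) (h0 : 0 ≤ θ) (h1 : θ ≤ π) :
    volume ({φ : ℝ | sgn (sin φ) ≠ sgn (sin (φ + θ))} ∩ Set.Ioo (-π) π) = ENNReal.ofReal (2 * θ) := by
  have hpi := Real.pi_pos
  have key : ∀ φ ∈ Set.Ioo (-π) π, sgn (sin φ) ≠ sgn (sin (φ + θ)) ↔
      φ ∈ Set.Ico (-θ) 0 ∪ Set.Ioo (π - θ) π := by
    rintro φ ⟨ha, hb⟩
    have h2 : 0 ≤ sin φ ↔ 0 ≤ φ := by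
      constructor
      · intro h; by_contra! h'
        exact absurd (Real.sin_neg_of_neg_of_neg_pi_lt h' ha) (by linarith)
      · intro h; exact Real.sin_nonneg_of_nonneg_of_le_pi h hb.le
    have h3 : 0 ≤ sin (φ + θ) ↔ (-θ ≤ φ ∧ φ ≤ π - θ) := by
      constructor
      · intro h
        constructor
        · by_contra! h'
          exact absurd (Real.sin_neg_of_neg_of_neg_pi_lt (x := φ + θ) (by linarith) (by linarith)) (by linarith)
        · by_contra! h'
          have := Real.sin_pos_of_pos_of_lt_pi (x := φ + θ - π) (by linarith) (by linarith)
          rw [Real.sin_sub_pi] at this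
          linarith
      · rintro ⟨h, h'⟩; exact Real.sin_nonneg_of_nonneg_of_le_pi (by linarith) (by linarith)
    simp only [sgn, h2, h3, Set.mem_union, Set.mem_Ico, Set.mem_Ioo]
    split_ifs with u v v
    · simp only [ne_eq, not_true, false_iff]; rintro (w | w) <;> linarith [v.1, v.2, w.1, w.2]
    · have : φ > π - θ := by by_contra! w; exact v ⟨by linarith, w⟩
      norm_num; right; exact ⟨by linarith, hb⟩
    · norm_num; left; exact ⟨by linarith [v.1], by linarith⟩
    · simp only [ne_eq, not_true, false_iff]; rintro (w | w)
      · exact v ⟨w.1, by linarith [w.2]⟩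
      · linarith [w.1, w.2]
  have e : ({φ : ℝ | sgn (sin φ) ≠ sgn (sin (φ + θ))} ∩ Set.Ioo (-π) π) =
     (Set.Ico (-θ) 0 ∪ Set.Ioo (π - θ) π) ∩ Set.Ioo (-π) π := by
    ext φ
    constructor
    · rintro ⟨a, b⟩; exact ⟨(key φ b).1 a, b⟩
    · rintro ⟨a, b⟩; exact ⟨(key φ b).2 a, b⟩
  rw [e, measure_congr ((ae_eq_refl _).inter (Ioo_ae_eq_Icc (a := -π) (b := π)))]
  rw [Set.inter_eq_left.2, measure_union _ measurableSet_Ioo, Real.volume_Ico, Real.volume_Ioo,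
    ← ENNReal.ofReal_add (by linarith) (by linarith)]
  · congr 1; ring
  · rw [Set.disjoint_left]; rintro φ ⟨_, a⟩ ⟨b, _⟩; linarith
  · rintro φ (⟨a, b⟩ | ⟨a, b⟩) <;> constructor <;> linarith

lemma measurable_sgn : Measurable sgn :=
  Measurable.ite measurableSet_Ici measurable_const measurable_const

lemma sgn_mul (r t : ℝ) (hr : 0 < r) : sgn (r * t) = sgn t := by
  simp [sgn, mul_nonneg_iff_of_pos_left hr]

/-- Gaussian measure of a cone. -/
lemma cone_measure : ∃ C : ENNReal, ∀ B : Set (ℝ × ℝ), MeasurableSet B → 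
    (∀ r : ℝ, 0 < r → ∀ u v, ((r * u, r * v) ∈ B ↔ (u, v) ∈ B)) →
    ((gaussianReal 0 1).prod (gaussianReal 0 1)) B =
      C * volume ({φ : ℝ | (cos φ, sin φ) ∈ B} ∩ Set.Ioo (-π) π) := by
  refine ⟨∫⁻ r in Set.Ioi 0, ENNReal.ofReal r * ENNReal.ofReal ((2 * π)⁻¹ * exp (-r^2/2)), ?_⟩
  intro B hB hcone
  have hm : Measurable fun φ : ℝ => (cos φ, sin φ) := by fun_prop
  rw [gaussianReal_of_var_ne_zero 0 one_ne_zero, prod_withDensity (by fun_prop) (by fun_prop),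
    withDensity_apply _ hB, ← lintegral_indicator hB]
  rw [← Measure.volume_eq_prod, ← lintegral_comp_polarCoord_symm]
  rw [polarCoord_target, Measure.volume_eq_prod, ← Measure.prod_restrict]
  have hS : MeasurableSet {φ : ℝ | (cos φ, sin φ) ∈ B} := hm hB
  rw [← Measure.restrict_apply hS, ← lintegral_indicator_one hS,
    ← lintegral_prod_mul (by fun_prop) ((measurable_one.indicator hS).aemeasurable)]
  rw [Measure.prod_restrict]
  apply setLIntegral_congr_fun (measurableSet_Ioi.prod measurableSet_Ioo)
  rintro ⟨r, φ⟩ ⟨hr, hφ⟩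
  have hr : 0 < r := hr
  simp only [polarCoord_symm_apply, smul_eq_mul]
  rw [mul_assoc]
  congr 1
  by_cases h : (cos φ, sin φ) ∈ B
  · rw [Set.indicator_of_mem ((hcone r hr _ _).2 h), Set.indicator_of_mem (show φ ∈ {φ : ℝ | (cos φ, sin φ) ∈ B} from h)]
    simp only [gaussianPDF, gaussianPDFReal, Pi.one_apply, mul_one]
    rw [← ENNReal.ofReal_mul (by positivity)]
    congr 1
    have : √(2 * π) ^ 2 = 2 * π := Real.sq_sqrt (by positivity)
    simp only [NNReal.coe_one, mul_one, sub_zero]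
    rw [mul_mul_mul_comm, ← Real.exp_add, ← mul_inv, ← sq, this]
    congr 2
    have := Real.sin_sq_add_cos_sq φ
    linear_combination (-r^2/2) * this
  · rw [Set.indicator_of_notMem (fun h' => h ((hcone r hr _ _).1 h')), Set.indicator_of_notMem (show φ ∉ {φ : ℝ | (cos φ, sin φ) ∈ B} from h)]
    simp

lemma single_prob {p : ℕ} (x y : Fin p → ℝ) (hx : ∑ i, (x i)^2 = 1) (hy : ∑ i, (y i)^2 = 1) :
    (Measure.pi (fun _ : Fin p => gaussianReal 0 1))
      {a | sgn (∑ j, a j * x j) ≠ sgn (∑ j, a j * y j)} =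
      ENNReal.ofReal (arccos (∑ j, x j * y j) / π) := by
  set c := ∑ j, x j * y j with hc
  set θ := arccos c with hθ
  have hcs : c^2 ≤ 1 := by
    have := Finset.sum_mul_sq_le_sq_mul_sq Finset.univ x y
    rw [hx, hy] at this; simpa using this
  have hcθ : cos θ = c := Real.cos_arccos (by nlinarith) (by nlinarith)
  have hD : MeasurableSet {q : ℝ × ℝ | sgn q.1 ≠ sgn q.2} :=
    (measurableSet_eq_fun (measurable_sgn.comp measurable_fst) (measurable_sgn.comp measurable_snd)).compl
  have hm : Measurable (fun u : ℝ × ℝ => (u.2, c * u.2 + sin θ * u.1)) := by fun_prop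
  have key := congrArg (fun ν => ν {q : ℝ × ℝ | sgn q.1 ≠ sgn q.2})
    (law_eq x y hx hy c (sin θ) hc.symm (by rw [← hcθ]; exact Real.cos_sq_add_sin_sq θ))
  rw [Measure.map_apply (by fun_prop) hD, Measure.map_apply hm hD] at key
  refine Eq.trans key ?_
  obtain ⟨C, hC⟩ := cone_measure
  have h1 := hC Set.univ .univ (by simp)
  simp only [measure_univ, Set.mem_univ, Set.setOf_true, Set.univ_inter, Real.volume_Ioo] at h1
  rw [hC _ (hm hD)]
  · have := angle_vol θ (arccos_nonneg _) (arccos_le_pi _)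
    have e : {φ : ℝ | (cos φ, sin φ) ∈ (fun u : ℝ × ℝ => (u.2, c * u.2 + sin θ * u.1)) ⁻¹' {q : ℝ × ℝ | sgn q.1 ≠ sgn q.2}} = {φ : ℝ | sgn (sin φ) ≠ sgn (sin (φ + θ))} := by
      ext φ
      simp only [Set.mem_preimage, Set.mem_setOf_eq, Real.sin_add, hcθ]
      rw [mul_comm c, mul_comm (sin θ)]
    rw [e, this]
    have : ENNReal.ofReal (2 * θ) = ENNReal.ofReal (π - -π) * ENNReal.ofReal (θ / π) := by
      rw [← ENNReal.ofReal_mul (by linarith [Real.pi_pos])]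
      congr 1; field_simp; ring
    rw [this, ← mul_assoc, ← h1, one_mul]
  · intro r hr u v
    have : c * (r * v) + sin θ * (r * u) = r * (c * v + sin θ * u) := by ring
    simp only [Set.mem_preimage, Set.mem_setOf_eq, this, sgn_mul _ _ hr]

lemma hoeff {p m : ℕ} (hm : 0 < m) (δ : ℝ) (hδ : 0 < δ) (ν : Measure (Fin p → ℝ)) [IsProbabilityMeasure ν]
    (S : Set (Fin p → ℝ)) (hS : MeasurableSet S) (σ : ℝ) (hσ : σ = 1 ∨ σ = -1) :
    (Measure.pi (fun _ : Fin m => ν)).real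
      {a | δ * m ≤ ∑ i, σ * (S.indicator 1 (a i) - ν.real S)} ≤ exp (-2 * δ^2 * m) := by
  have hmeas : Measurable (S.indicator (1 : (Fin p → ℝ) → ℝ)) := measurable_one.indicator hS
  have hsub1 : HasSubgaussianMGF (fun a => σ * (S.indicator (1 : (Fin p → ℝ) → ℝ) a - ν.real S)) (1/4) ν := by
    have h := hasSubgaussianMGF_of_mem_Icc (μ := ν) (a := 0) (b := 1) hmeas.aemeasurable
      (.of_forall fun a => ⟨Set.indicator_nonneg (by simp) _, Set.indicator_le_self' (by simp) _⟩)
    rw [integral_indicator_one hS] at h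
    have e : ((‖(1:ℝ) - 0‖₊ / 2) ^ 2) = 1/4 := by ext; simp; norm_num
    rw [e] at h
    rcases hσ with rfl | rfl
    · simpa using h
    · convert h.neg using 2 <;> simp
  have hsub : ∀ i ∈ (Finset.univ : Finset (Fin m)), HasSubgaussianMGF
      (fun a : Fin m → Fin p → ℝ => σ * (S.indicator (1 : (Fin p → ℝ) → ℝ) (a i) - ν.real S)) (1/4)
      (Measure.pi (fun _ : Fin m => ν)) := by
    intro i _
    have := (measurePreserving_eval (fun _ : Fin m => ν) i)
    rw [← this.map_eq] at hsub1
    have h2 := hsub1.of_map this.measurable.aemeasurable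
    rw [this.map_eq] at h2
    exact h2
  have hind := iIndepFun_pi (μ := fun _ : Fin m => ν)
    (X := fun _ a => σ * (S.indicator (1 : (Fin p → ℝ) → ℝ) a - ν.real S)) (fun i => by fun_prop)
  have := HasSubgaussianMGF.measure_sum_ge_le_of_iIndepFun hind hsub (ε := δ * m) (by positivity)
  refine this.trans (le_of_eq ?_)
  congr 1
  simp
  field_simp
  norm_num

lemma pair_bound {p m : ℕ} (hm : 0 < m) (δ : ℝ) (hδ : 0 < δ) (x y : Fin p → ℝ)
    (hx : ∑ i, (x i)^2 = 1) (hy : ∑ i, (y i)^2 = 1) :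
    (Measure.pi (fun _ : Fin m => Measure.pi (fun _ : Fin p => gaussianReal 0 1)))
      {a | δ < |((Finset.univ.filter (fun i : Fin m =>
              sgn (∑ j, a i j * x j) ≠ sgn (∑ j, a i j * y j))).card : ℝ) / m
            - arccos (∑ j, x j * y j) / π|} ≤ ENNReal.ofReal (2 * exp (-2 * δ^2 * m)) := by
  set ν := Measure.pi (fun _ : Fin p => gaussianReal 0 1) with hν
  set S : Set (Fin p → ℝ) := {a | sgn (∑ j, a j * x j) ≠ sgn (∑ j, a j * y j)} with hSdef
  have hS : MeasurableSet S := by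
    have h1 : Measurable fun a : Fin p → ℝ => sgn (∑ j, a j * x j) :=
      measurable_sgn.comp (by fun_prop)
    have h2 : Measurable fun a : Fin p → ℝ => sgn (∑ j, a j * y j) :=
      measurable_sgn.comp (by fun_prop)
    exact (measurableSet_eq_fun h1 h2).compl
  have hd : ν.real S = arccos (∑ j, x j * y j) / π := by
    rw [measureReal_def, single_prob x y hx hy, ENNReal.toReal_ofReal]
    exact div_nonneg (arccos_nonneg _) Real.pi_pos.le
  have b1 := hoeff hm δ hδ ν S hS 1 (Or.inl rfl)
  have b2 := hoeff hm δ hδ ν S hS (-1) (Or.inr rfl)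
  have hm' : (0 : ℝ) < m := by exact_mod_cast hm
  rw [← hd, ← ofReal_measureReal]
  apply ENNReal.ofReal_le_ofReal
  rw [two_mul]
  refine le_trans (le_trans (measureReal_mono ?_) (measureReal_union_le _ _)) (add_le_add b1 b2)
  intro a ha
  simp only [Set.mem_setOf_eq] at ha
  have hcard : ((Finset.univ.filter (fun i : Fin m =>
      sgn (∑ j, a i j * x j) ≠ sgn (∑ j, a i j * y j))).card : ℝ) =
      ∑ i, S.indicator (1 : (Fin p → ℝ) → ℝ) (a i) := by
    rw [Finset.card_filter]
    push_cast
    apply Finset.sum_congr rfl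
    intro i _
    simp [Set.indicator_apply, hSdef]
  rw [hcard] at ha
  have hsum : ∀ σ : ℝ, ∑ i, σ * (S.indicator (1 : (Fin p → ℝ) → ℝ) (a i) - ν.real S) =
      σ * ((∑ i, S.indicator (1 : (Fin p → ℝ) → ℝ) (a i)) / m - ν.real S) * m := by
    intro σ
    rw [← Finset.mul_sum, Finset.sum_sub_distrib]
    simp
    field_simp
  simp only [Set.mem_union, Set.mem_setOf_eq, hsum]
  rcases lt_abs.1 ha with h | h
  · left; exact mul_le_mul_of_nonneg_right (by linarith) hm'.le
  · right; exact mul_le_mul_of_nonneg_right (by linarith) hm'.le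

theorem urp_finite_embedding :
    ∃ c > 0, ∀ (p m : ℕ) (_ : 0 < m) (δ : ℝ) (_ : 0 < δ)
      (K : Finset (Fin p → ℝ)) (_ : ∀ x ∈ K, ∑ i, (x i)^2 = 1)
      (Ω : Type) (_ : MeasurableSpace Ω) (μ : Measure Ω) (_ : IsProbabilityMeasure μ)
      (A : Ω → (Fin m → Fin p → ℝ)) (_ : Measurable A)
      (_ : μ.map A = Measure.pi (fun _ => Measure.pi (fun _ => gaussianReal 0 1))),
      (m : ℝ) ≥ c * (1 / δ^2) * Real.log K.card →
      μ {ω | ∀ x ∈ K, ∀ y ∈ K,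
          |((Finset.univ.filter (fun i : Fin m =>
              sgn (∑ j, A ω i j * x j) ≠ sgn (∑ j, A ω i j * y j))).card : ℝ) / m
            - arccos (∑ j, x j * y j) / π| ≤ δ}
        ≥ ENNReal.ofReal (1 - 2 * Real.exp (-δ^2 * m)) := by
  refine ⟨2, by norm_num, ?_⟩
  intro p m hm δ hδ K hK Ω _ μ _ A hA hlaw hmK
  have hm' : (0 : ℝ) < m := by exact_mod_cast hm
  set G : Set Ω := {ω | ∀ x ∈ K, ∀ y ∈ K,
          |((Finset.univ.filter (fun i : Fin m =>
              sgn (∑ j, A ω i j * x j) ≠ sgn (∑ j, A ω i j * y j))).card : ℝ) / m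
            - arccos (∑ j, x j * y j) / π| ≤ δ} with hG
  have hcompl : μ Gᶜ ≤ ENNReal.ofReal (2 * exp (-δ^2 * m)) := by
    have hsub : Gᶜ ⊆ ⋃ q ∈ K ×ˢ K, A ⁻¹' {a | δ < |((Finset.univ.filter (fun i : Fin m =>
              sgn (∑ j, a i j * q.1 j) ≠ sgn (∑ j, a i j * q.2 j))).card : ℝ) / m
            - arccos (∑ j, q.1 j * q.2 j) / π|} := by
      intro ω hω
      simp only [hG, Set.mem_compl_iff, Set.mem_setOf_eq] at hω
      push Not at hω
      obtain ⟨x, hx, y, hy, h⟩ := hω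
      simp only [Set.mem_iUnion]
      exact ⟨(x, y), Finset.mem_product.2 ⟨hx, hy⟩, h⟩
    refine (measure_mono hsub).trans ((measure_biUnion_finset_le _ _).trans ?_)
    have hb : ∀ q ∈ K ×ˢ K, μ (A ⁻¹' {a | δ < |((Finset.univ.filter (fun i : Fin m =>
              sgn (∑ j, a i j * q.1 j) ≠ sgn (∑ j, a i j * q.2 j))).card : ℝ) / m
            - arccos (∑ j, q.1 j * q.2 j) / π|}) ≤ ENNReal.ofReal (2 * exp (-2 * δ^2 * m)) := by
      intro q hq
      obtain ⟨h1, h2⟩ := Finset.mem_product.1 hq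
      refine (Measure.le_map_apply hA.aemeasurable _).trans ?_
      rw [hlaw]
      exact pair_bound hm δ hδ q.1 q.2 (hK _ h1) (hK _ h2)
    refine (Finset.sum_le_sum hb).trans ?_
    rw [Finset.sum_const, nsmul_eq_mul, ← ENNReal.ofReal_natCast,
      ← ENNReal.ofReal_mul (by positivity)]
    apply ENNReal.ofReal_le_ofReal
    rw [Finset.card_product]
    have hN : ((K.card * K.card : ℕ) : ℝ) ≤ exp (δ^2 * m) := by
      rcases Nat.eq_zero_or_pos K.card with h0 | h0
      · rw [h0]; simp; positivity
      · have h0' : (0 : ℝ) < K.card := by exact_mod_cast h0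
        have h3 : 2 * Real.log K.card ≤ δ^2 * m := by
          have h4 := mul_le_mul_of_nonneg_left hmK (sq_nonneg δ)
          have h5 : δ^2 * (2 * (1 / δ^2) * Real.log K.card) = 2 * Real.log K.card := by
            field_simp
          linarith
        calc ((K.card * K.card : ℕ) : ℝ) = exp (2 * Real.log K.card) := by
              rw [two_mul, Real.exp_add, Real.exp_log h0']; push_cast; ring
          _ ≤ _ := Real.exp_le_exp.2 h3
    calc ((K.card * K.card : ℕ) : ℝ) * (2 * exp (-2 * δ^2 * m))
        ≤ exp (δ^2 * m) * (2 * exp (-2 * δ^2 * m)) :=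
          mul_le_mul_of_nonneg_right hN (by positivity)
      _ = 2 * exp (-δ^2 * m) := by
          rw [mul_left_comm, ← Real.exp_add]; congr 2; ring
  have h1 : (1 : ENNReal) ≤ μ G + μ Gᶜ := by
    rw [← measure_univ (μ := μ), ← Set.union_compl_self G]
    exact measure_union_le _ _
  rw [ge_iff_le, ENNReal.ofReal_sub _ (by positivity), ENNReal.ofReal_one]
  exact tsub_le_iff_right.2 (h1.trans (by gcongr))
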